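/- arXiv:2108.01168 — 3 statements merged into one kernel-verified Lean document; each statement's English description precedes it below -/
import Mathlib

section
/- If D is an H-colored tournament, then for every k ≥ 3, D has a (k,H)-kernel. -/
/-!
Setting: `A : V → V → Prop` is the arc relation of a loopless digraph `D`,
`AH : VH → VH → Prop` is the arc relation of a digraph `H` (possibly with loops),
and `ρ : V → V → VH` colors each arc of `D` with a vertex of `H`
(`D` is an `H`-colored digraph).
-/

open scoped Classical

noncomputable section

variable {V VH : Type*}

/-- `x 0, x 1, …, x n` is a walk of length `n` in the digraph with arc relation `A`. -/
def IsWalk (A : V → V → Prop) (n : ℕ) (x : ℕ → V) : Prop :=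
  ∀ i < n, A (x i) (x (i + 1))

/-- A (directed) path of length `n`: a walk whose `n + 1` vertices are pairwise distinct. -/
def IsPath (A : V → V → Prop) (n : ℕ) (x : ℕ → V) : Prop :=
  IsWalk A n x ∧ ∀ i ≤ n, ∀ j ≤ n, x i = x j → i = j

/-- A (directed) cycle of length `n`: a nontrivial closed walk whose first `n` vertices are
pairwise distinct. -/
def IsCycle (A : V → V → Prop) (n : ℕ) (x : ℕ → V) : Prop :=
  IsWalk A n x ∧ x n = x 0 ∧ 1 ≤ n ∧ ∀ i < n, ∀ j < n, x i = x j → i = j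

/-- The set `O_H(W)` of obstructions of an open walk `W = (x 0, …, x n)`: the indices
`i ∈ {1, …, n-1}` such that `(ρ(x_{i-1}, x_i), ρ(x_i, x_{i+1}))` is not an arc of `H`. -/
def obstrOpen (AH : VH → VH → Prop) (ρ : V → V → VH) (n : ℕ) (x : ℕ → V) : Finset ℕ :=
  (Finset.Ico 1 n).filter fun i => ¬ AH (ρ (x (i - 1)) (x i)) (ρ (x i) (x (i + 1)))

/-- The set `O_H(W)` of obstructions of a closed walk `W = (x 0, …, x n)` (`x n = x 0`):
the indices `i ∈ {0, …, n-1}`, taken modulo `n`, such that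
`(ρ(x_{i-1}, x_i), ρ(x_i, x_{i+1}))` is not an arc of `H`. -/
def obstrClosed (AH : VH → VH → Prop) (ρ : V → V → VH) (n : ℕ) (x : ℕ → V) : Finset ℕ :=
  (Finset.range n).filter fun i =>
    ¬ AH (ρ (x (if i = 0 then n - 1 else i - 1)) (x i)) (ρ (x i) (x (i + 1)))

/-- The `H`-length of an open walk: `|O_H(W)| + 1`. -/
def HLenOpen (AH : VH → VH → Prop) (ρ : V → V → VH) (n : ℕ) (x : ℕ → V) : ℕ :=
  (obstrOpen AH ρ n x).card + 1

/-- The `H`-length of a closed walk: `|O_H(W)|`. -/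
def HLenClosed (AH : VH → VH → Prop) (ρ : V → V → VH) (n : ℕ) (x : ℕ → V) : ℕ :=
  (obstrClosed AH ρ n x).card

/-- `(u,v)` is an arc of the `(l,H)`-closure `C_H^l(D)` iff there exists a `uv`-path in `D`
with `H`-length at most `l`. -/
def ClosureAdj (A : V → V → Prop) (AH : VH → VH → Prop) (ρ : V → V → VH) (l : ℕ)
    (u v : V) : Prop :=
  ∃ n x, 1 ≤ n ∧ IsPath A n x ∧ x 0 = u ∧ x n = v ∧ HLenOpen AH ρ n x ≤ l

/-- `S` is `(k,H)`-independent: every path between two different vertices of `S`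
has `H`-length at least `k`. -/
def KHIndependent (A : V → V → Prop) (AH : VH → VH → Prop) (ρ : V → V → VH)
    (k : ℕ) (S : Set V) : Prop :=
  ∀ u ∈ S, ∀ v ∈ S, u ≠ v →
    ∀ n x, IsPath A n x → x 0 = u → x n = v → k ≤ HLenOpen AH ρ n x

/-- `S` is `(l,H)`-absorbent: from every vertex outside `S` there exists a path to some
vertex of `S` with `H`-length at most `l`. -/
def LHAbsorbent (A : V → V → Prop) (AH : VH → VH → Prop) (ρ : V → V → VH)
    (l : ℕ) (S : Set V) : Prop :=
  ∀ v ∉ S, ∃ w ∈ S, ∃ n x, IsPath A n x ∧ x 0 = v ∧ x n = w ∧ HLenOpen AH ρ n x ≤ l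

/-- A `(k,H)`-kernel: a `(k,H)`-independent and `(k-1,H)`-absorbent set of vertices. -/
def IsKHKernel (A : V → V → Prop) (AH : VH → VH → Prop) (ρ : V → V → VH)
    (k : ℕ) (S : Set V) : Prop :=
  KHIndependent A AH ρ k S ∧ LHAbsorbent A AH ρ (k - 1) S

/-- A kernel of a digraph: an independent and absorbent set of vertices. -/
def IsKernel (A : V → V → Prop) (S : Set V) : Prop :=
  (∀ u ∈ S, ∀ v ∈ S, u ≠ v → ¬ A u v) ∧ ∀ u ∉ S, ∃ v ∈ S, A u v

/-- A tournament: every two different vertices are joined by exactly one arc. -/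
def IsTournamentRel (A : V → V → Prop) : Prop :=
  ∀ u v : V, u ≠ v → (A u v ↔ ¬ A v u)

/-- A finite nonempty tournament has a vertex reachable from every other vertex by one arc or
by two consecutive arcs. -/
theorem IsTournamentRel.exists_king [Fintype V] [Nonempty V] {A : V → V → Prop}
    (hloopless : ∀ v : V, ¬ A v v) (htour : IsTournamentRel A) :
    ∃ w, ∀ v, v ≠ w → A v w ∨ ∃ u, A v u ∧ A u w := by
  obtain ⟨w, hw⟩ := Finite.exists_max fun w => (Finset.univ.filter fun u => A u w).card
  refine ⟨w, fun v hv => ?_⟩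
  by_contra! h
  obtain ⟨hvw, hu⟩ := h
  refine (hw v).not_gt (Finset.card_lt_card ?_)
  rw [Finset.ssubset_iff_of_subset]
  · exact ⟨w, by simpa using (htour w v hv.symm).2 hvw, by simpa using hloopless w⟩
  · intro u huw
    simp only [Finset.mem_filter, Finset.mem_univ, true_and] at huw ⊢
    have hne : u ≠ v := fun h => hvw (h ▸ huw)
    exact (htour u v hne).2 fun hvu => hu u hvu huw

theorem HLenOpen_le {AH : VH → VH → Prop} {ρ : V → V → VH} {n : ℕ} (hn : 1 ≤ n) (x : ℕ → V) :
    HLenOpen AH ρ n x ≤ n := by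
  have h := Finset.card_filter_le (Finset.Ico 1 n)
    fun i => ¬ AH (ρ (x (i - 1)) (x i)) (ρ (x i) (x (i + 1)))
  rw [Nat.card_Ico] at h
  unfold HLenOpen obstrOpen
  omega

/-- Every `H`-colored tournament has a `(k,H)`-kernel for every `k ≥ 3`. -/
theorem tournament_has_kHKernel [Fintype V]
    (A : V → V → Prop) (hloopless : ∀ v : V, ¬ A v v)
    (htour : IsTournamentRel A)
    (AH : VH → VH → Prop) (ρ : V → V → VH)
    (k : ℕ) (hk : 3 ≤ k) :
    ∃ S : Set V, IsKHKernel A AH ρ k S := by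
  cases isEmpty_or_nonempty V with
  | inl h => exact ⟨∅, fun u => h.elim u, fun v => h.elim v⟩
  | inr h =>
    obtain ⟨w, hw⟩ := htour.exists_king hloopless
    refine ⟨{w}, fun u hu v hv huv => absurd (hu.trans hv.symm) huv, fun v hv => ⟨w, rfl, ?_⟩⟩
    have hvw : v ≠ w := hv
    rcases hw v hvw with hA | ⟨u, hvu, huw⟩
    · refine ⟨1, fun i => if i = 0 then v else w, ⟨?_, ?_⟩, by simp, by simp,
        (HLenOpen_le le_rfl _).trans (by omega)⟩
      · intro i hi
        interval_cases i
        simpa using hA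
      · intro i hi j hj hij
        interval_cases i <;> interval_cases j <;> simp_all
    · have h₁ : v ≠ u := fun h => hloopless u (h ▸ hvu)
      have h₂ : u ≠ w := fun h => hloopless w (h ▸ huw)
      refine ⟨2, fun i => if i = 0 then v else if i = 1 then u else w, ⟨?_, ?_⟩,
        by simp, by simp, (HLenOpen_le (by omega) _).trans (by omega)⟩
      · intro i hi
        interval_cases i
        · simpa using hvu
        · simpa using huw
      · intro i hi j hj hij
        interval_cases i <;> interval_cases j <;> simp_all
end
end

section
/- Let D be an H-colored 3-quasi-transitive digraph, k ≥ 5, and suppose (u,v) is an arc of the (k−1,H)-closure C_H^{k−1}(D). If (u,v) is an asymmetric arc in C_H^{k−1}(D) (i.e., (v,u) is not an arc of C_H^{k−1}(D)), then the distance from u to v in D satisfies d_D(u,v) ≤ 2. -/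
/-!
Setting: `A : V → V → Prop` is the arc relation of a loopless digraph `D`,
`AH : VH → VH → Prop` is the arc relation of a digraph `H` (possibly with loops),
and `ρ : V → V → VH` colors each arc of `D` with a vertex of `H`
(`D` is an `H`-colored digraph).
-/

open scoped Classical

noncomputable section

variable {V VH : Type*}

/-- A digraph is `3`-quasi-transitive if the endpoints of every path of length `3` are
joined by an arc. -/
def ThreeQuasiTransitive (A : V → V → Prop) : Prop :=
  ∀ x : ℕ → V, IsPath A 3 x → A (x 0) (x 3) ∨ A (x 3) (x 0)

theorem hLenOpen_le (AH : VH → VH → Prop) (ρ : V → V → VH) {n : ℕ} (hn : 1 ≤ n) (x : ℕ → V) :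
    HLenOpen AH ρ n x ≤ n := by
  have h : (obstrOpen AH ρ n x).card ≤ (Finset.Ico 1 n).card := Finset.card_filter_le _ _
  rw [Nat.card_Ico] at h
  unfold HLenOpen
  omega

theorem IsPath.closureAdj {A : V → V → Prop} {n : ℕ} {x : ℕ → V} (h : IsPath A n x)
    (AH : VH → VH → Prop) (ρ : V → V → VH) (hn : 1 ≤ n) {l : ℕ} (hl : n ≤ l) :
    ClosureAdj A AH ρ l (x 0) (x n) :=
  ⟨n, x, hn, h, rfl, rfl, (hLenOpen_le AH ρ hn x).trans hl⟩

/-- In a `3`-quasi-transitive digraph, a path of length `3` given by its four vertices has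
adjacent endpoints. -/
theorem ThreeQuasiTransitive.adj {A : V → V → Prop} (h : ThreeQuasiTransitive A) {a b c d : V}
    (hab : A a b) (hbc : A b c) (hcd : A c d) (hne : [a, b, c, d].Nodup) : A a d ∨ A d a := by
  refine h (fun i => [a, b, c, d].getD i a) ⟨fun i hi => ?_, fun i hi j hj hij => ?_⟩
  · interval_cases i <;> simpa
  · have hi' : i < [a, b, c, d].length := by simp; omega
    have hj' : j < [a, b, c, d].length := by simp; omega
    simp only [List.getD_eq_getElem _ _ hi', List.getD_eq_getElem _ _ hj'] at hij
    exact (hne.getElem_inj_iff).1 hij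

/-- Replacing the segment of a path between `x i` and `x j` by an arc yields a path. -/
theorem IsPath.splice {A : V → V → Prop} {n : ℕ} {x : ℕ → V} (h : IsPath A n x) {i j : ℕ}
    (hij : i < j) (hj : j ≤ n) (hA : A (x i) (x j)) :
    IsPath A (n - (j - i - 1)) fun t => if t ≤ i then x t else x (t + (j - i - 1)) := by
  refine ⟨fun t ht => ?_, fun s hs t ht hst => ?_⟩
  · rcases lt_trichotomy t i with hti | rfl | hti
    · simpa [hti.le, Nat.succ_le_of_lt hti] using h.1 t (by omega)
    · have : t + 1 + (j - t - 1) = j := by omega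
      simpa [this] using hA
    · have := h.1 (t + (j - i - 1)) (by omega)
      simpa [hti.not_ge, show ¬ t + 1 ≤ i by omega, Nat.add_right_comm] using this
  · dsimp only at hst
    split_ifs at hst <;> have := h.2 _ (by omega) _ (by omega) hst <;> omega

/-- Any two vertices joined by a path are joined by a chordless path, in the sense that no arc
skips vertices forward. -/
theorem IsPath.exists_chordless {A : V → V → Prop} {n : ℕ} {x : ℕ → V} (h : IsPath A n x) :
    ∃ m y, IsPath A m y ∧ y 0 = x 0 ∧ y m = x n ∧
      ∀ i j, i + 1 < j → j ≤ m → ¬ A (y i) (y j) := by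
  have hex : ∃ m y, IsPath A m y ∧ y 0 = x 0 ∧ y m = x n := ⟨n, x, h, rfl, rfl⟩
  obtain ⟨y, hy, hy0, hym⟩ := Nat.find_spec hex
  refine ⟨Nat.find hex, y, hy, hy0, hym, fun i j hij hj hA => ?_⟩
  refine Nat.find_min hex (m := Nat.find hex - (j - i - 1)) (by omega)
    ⟨_, hy.splice (by omega) hj hA, by simpa using hy0, ?_⟩
  rw [if_neg (by omega), Nat.sub_add_cancel (by omega), hym]

/-- Along a chordless path of a `3`-quasi-transitive digraph there is a backward arc between any
two vertices whose indices differ by an odd number other than `1`. -/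
theorem ThreeQuasiTransitive.adj_back {A : V → V → Prop} (h : ThreeQuasiTransitive A) {n : ℕ}
    {x : ℕ → V} (hx : IsPath A n x) (hc : ∀ i j, i + 1 < j → j ≤ n → ¬ A (x i) (x j))
    (m i : ℕ) (hi : i + (2 * m + 3) ≤ n) : A (x (i + (2 * m + 3))) (x i) := by
  have hinj : ∀ {a b}, a ≤ n → b ≤ n → a ≠ b → x a ≠ x b :=
    fun ha hb hab he => hab (hx.2 _ ha _ hb he)
  have hthree : ∀ a, a + 3 ≤ n → A (x (a + 3)) (x a) := fun a ha =>
    (h.adj (hx.1 a (by omega)) (hx.1 (a + 1) (by omega)) (hx.1 (a + 2) (by omega)) (by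
      simp only [List.nodup_cons, List.mem_cons, List.not_mem_nil, or_false, not_or]
      refine ⟨⟨?_, ?_, ?_⟩, ⟨?_, ?_⟩, ?_, not_false, List.nodup_nil⟩ <;>
        apply hinj <;> omega)).resolve_left
      (hc _ _ (by omega) ha)
  induction m generalizing i with
  | zero => exact hthree i hi
  | succ m ih =>
    have hlong := ih (i + 2) (by omega)
    rw [show i + 2 + (2 * m + 3) = i + (2 * (m + 1) + 3) by ring] at hlong
    refine (h.adj hlong (hx.1 (i + 2) (by omega)) (hthree i (by omega)) ?_).resolve_right
      (hc _ _ (by omega) hi)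
    simp only [List.nodup_cons, List.mem_cons, List.not_mem_nil, or_false, not_or]
    refine ⟨⟨?_, ?_, ?_⟩, ⟨?_, ?_⟩, ?_, not_false, List.nodup_nil⟩ <;> apply hinj <;> omega

/-- In an `H`-colored `3`-quasi-transitive digraph, if `(u,v)` is an asymmetric arc of
the `(k-1,H)`-closure (`k ≥ 5`), then `d_D(u,v) ≤ 2`. -/
theorem threeQuasiTransitive_dist_le_two_of_asymmetric_closureAdj
    (A : V → V → Prop) (hloopless : ∀ v : V, ¬ A v v)
    (h3qt : ThreeQuasiTransitive A)
    (AH : VH → VH → Prop) (ρ : V → V → VH)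
    (k : ℕ) (hk : 5 ≤ k)
    (u v : V)
    (harc : ClosureAdj A AH ρ (k - 1) u v)
    (hasym : ¬ ClosureAdj A AH ρ (k - 1) v u) :
    ∃ n x, IsPath A n x ∧ x 0 = u ∧ x n = v ∧ n ≤ 2 := by
  obtain ⟨N, z, -, hz, rfl, rfl, -⟩ := harc
  obtain ⟨n, x, hx, hx0, hxn, hc⟩ := hz.exists_chordless
  refine ⟨n, x, hx, hx0, hxn, ?_⟩
  by_contra! hn
  rw [← hx0, ← hxn] at hasym
  apply hasym
  have hback := h3qt.adj_back hx hc
  rcases Nat.even_or_odd' n with ⟨m, rfl | rfl⟩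
  · obtain ⟨m, rfl⟩ : ∃ l, m = l + 2 := ⟨m - 2, by omega⟩
    have hlong := hback m 1 (by omega)
    rw [show 1 + (2 * m + 3) = 2 * (m + 2) by ring] at hlong
    let e : ℕ → ℕ := fun i => [2 * (m + 2), 1, 2, 3, 0].getD i 0
    have hpath : IsPath A 4 (x ∘ e) := by
      refine ⟨fun i hi => ?_, fun i hi j hj hij => ?_⟩
      · interval_cases i
        · exact hlong
        · exact hx.1 1 (by omega)
        · exact hx.1 2 (by omega)
        · exact hback 0 0 (by omega)
      · have hle : ∀ t, t ≤ 4 → e t ≤ 2 * (m + 2) := fun t ht => by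
          interval_cases t <;> simp [e] <;> omega
        have he := hx.2 _ (hle i hi) _ (hle j hj) hij
        interval_cases i <;> interval_cases j <;> simp [e] at he ⊢ <;> omega
    exact hpath.closureAdj AH ρ (by omega) (by omega)
  · obtain ⟨m, rfl⟩ : ∃ l, m = l + 1 := ⟨m - 1, by omega⟩
    have hlong := hback m 0 (by omega)
    rw [show 0 + (2 * m + 3) = 2 * (m + 1) + 1 by ring] at hlong
    have hpath : IsPath A 1 fun i => if i = 0 then x (2 * (m + 1) + 1) else x 0 := by
      refine ⟨fun i hi => ?_, fun i hi j hj hij => ?_⟩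
      · interval_cases i
        simpa using hlong
      · have hne : x (2 * (m + 1) + 1) ≠ x 0 := fun he => hloopless _ (he ▸ hlong)
        interval_cases i <;> interval_cases j <;> simp_all
    exact hpath.closureAdj AH ρ le_rfl (by omega)
end
end

section
/- Let D be an H-colored r-quasi-transitive digraph (r ≥ 2) such that every cycle in D with length r+1 is an H-cycle. For every k ≥ r, D has a (k,H)-kernel. -/
/-!
Setting: `A : V → V → Prop` is the arc relation of a loopless digraph `D`,
`AH : VH → VH → Prop` is the arc relation of a digraph `H` (possibly with loops),
and `ρ : V → V → VH` colors each arc of `D` with a vertex of `H`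
(`D` is an `H`-colored digraph).
-/

open scoped Classical

noncomputable section

variable {V VH : Type*}

/-- A digraph is `r`-quasi-transitive if the endpoints of every path of length `r` are
joined by an arc. -/
def RQuasiTransitive (A : V → V → Prop) (r : ℕ) : Prop :=
  ∀ x : ℕ → V, IsPath A r x → A (x 0) (x r) ∨ A (x r) (x 0)

/-- The endpoints of a walk are joined by the reflexive transitive closure of the arc relation. -/
lemma IsWalk.reflTransGen {A : V → V → Prop} {n : ℕ} {x : ℕ → V} (hx : IsWalk A n x) :
    Relation.ReflTransGen A (x 0) (x n) := by
  induction n with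
  | zero => exact .refl
  | succ n ih => exact (ih fun i hi => hx i (by lia)).tail (hx n (by lia))

lemma exists_isWalk_of_reflTransGen {A : V → V → Prop} {u v : V}
    (h : Relation.ReflTransGen A u v) : ∃ n x, IsWalk A n x ∧ x 0 = u ∧ x n = v := by
  induction h with
  | refl => exact ⟨0, fun _ => u, fun i hi => absurd hi (by lia), rfl, rfl⟩
  | @tail b c _ hbc ih =>
    obtain ⟨n, x, hx, h0, hn⟩ := ih
    refine ⟨n + 1, fun m => if m ≤ n then x m else c, fun i hi => ?_, by simpa using h0, by simp⟩
    rcases Nat.lt_succ_iff_lt_or_eq.mp hi with hin | rfl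
    · simpa [hin.le, Nat.succ_le_of_lt hin] using hx i hin
    · simpa [hn] using hbc

/-- An arc between two vertices of a walk bypasses the part of the walk between them. -/
lemma IsWalk.exists_shortcut {A : V → V → Prop} {n : ℕ} {x : ℕ → V} (hx : IsWalk A n x)
    {i j : ℕ} (hij : i < j) (hj : j ≤ n) (hA : A (x i) (x j)) :
    ∃ y, IsWalk A (n - (j - i - 1)) y ∧ y 0 = x 0 ∧ y (n - (j - i - 1)) = x n := by
  refine ⟨fun m => if m ≤ i then x m else x (m + (j - i - 1)), fun m hm => ?_, by simp, ?_⟩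
  · rcases lt_trichotomy m i with h | rfl | h
    · simpa [h.le, Nat.succ_le_of_lt h] using hx m (by lia)
    · have : m + 1 + (j - m - 1) = j := by lia
      simpa [this] using hA
    · have h1 : ¬ m ≤ i := by lia
      have h2 : ¬ m + 1 ≤ i := by lia
      have := hx (m + (j - i - 1)) (by lia)
      simpa [h1, h2, add_right_comm] using this
  · have h1 : ¬ n - (j - i - 1) ≤ i := by lia
    have h2 : n - (j - i - 1) + (j - i - 1) = n := by lia
    simp [h1, h2]

/-- Reachable vertices are joined by a path along which every arc joining a vertex to a later
one joins consecutive vertices. -/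
lemma exists_isPath_of_reflTransGen {A : V → V → Prop} {u v : V}
    (h : Relation.ReflTransGen A u v) :
    ∃ n x, IsPath A n x ∧ x 0 = u ∧ x n = v ∧
      ∀ i j, i + 2 ≤ j → j ≤ n → ¬ A (x i) (x j) := by
  have hex := exists_isWalk_of_reflTransGen h
  obtain ⟨x, hx, h0, hn⟩ := Nat.find_spec hex
  have hmin : ∀ m < Nat.find hex, ∀ y, IsWalk A m y → y 0 = u → y m = v → False :=
    fun m hm y h1 h2 h3 => Nat.find_min hex hm ⟨y, h1, h2, h3⟩
  set n := Nat.find hex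
  have hchord : ∀ i j, i + 2 ≤ j → j ≤ n → ¬ A (x i) (x j) := by
    intro i j hij hj hA
    obtain ⟨y, hy, hy0, hyn⟩ := hx.exists_shortcut (by lia) hj hA
    exact hmin _ (by lia) y hy (hy0.trans h0) (hyn.trans hn)
  have hne : ∀ i j, i < j → j ≤ n → x i ≠ x j := by
    intro i j hij hj he
    rcases hj.lt_or_eq with hj | rfl
    · exact hchord i (j + 1) (by lia) hj (he ▸ hx j hj)
    · exact hmin i hij x (fun m hm => hx m (by lia)) h0 (he.trans hn)
  refine ⟨n, x, ⟨hx, fun i hi j hj he => ?_⟩, h0, hn, hchord⟩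
  by_contra hij
  rcases Nat.lt_or_gt_of_ne hij with h | h
  · exact hne i j h hj he
  · exact hne j i h hi he.symm

/-- If every cycle of length `r + 1` is an `H`-cycle, then a path of length `r` whose last vertex
sends an arc to its first one has no obstructions. -/
lemma IsPath.obstrOpen_eq_empty_of_arc {A : V → V → Prop} {AH : VH → VH → Prop} {ρ : V → V → VH}
    {r : ℕ} (hHcyc : ∀ y : ℕ → V, IsCycle A (r + 1) y → obstrClosed AH ρ (r + 1) y = ∅)
    {x : ℕ → V} (hx : IsPath A r x) (hA : A (x r) (x 0)) : obstrOpen AH ρ r x = ∅ := by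
  have hcyc : IsCycle A (r + 1) (fun m => if m ≤ r then x m else x 0) := by
    refine ⟨fun m hm => ?_, by simp, by lia, fun i hi j hj he => ?_⟩
    · rcases Nat.lt_succ_iff_lt_or_eq.mp hm with h | rfl
      · simpa [h.le, Nat.succ_le_of_lt h] using hx.1 m h
      · simpa using hA
    · exact hx.2 i (by lia) j (by lia)
        (by simpa [Nat.le_of_lt_succ hi, Nat.le_of_lt_succ hj] using he)
  refine Finset.filter_eq_empty_iff.mpr fun i hi => ?_
  rw [Finset.mem_Ico] at hi
  have h := Finset.filter_eq_empty_iff.mp (hHcyc _ hcyc) (Finset.mem_range.mpr (by lia : i < r + 1))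
  have h0 : i ≠ 0 := by lia
  have h1 : i - 1 ≤ r := by lia
  have h2 : i ≤ r := by lia
  have h3 : i + 1 ≤ r := by lia
  simpa only [h0, h1, h2, h3, if_true, if_false] using h

/-- A path without forward chords and of length at least `r` has no obstructions. -/
lemma IsPath.obstrOpen_eq_empty {A : V → V → Prop} {AH : VH → VH → Prop} {ρ : V → V → VH}
    {r : ℕ} (hr : 2 ≤ r) (hrqt : RQuasiTransitive A r)
    (hHcyc : ∀ y : ℕ → V, IsCycle A (r + 1) y → obstrClosed AH ρ (r + 1) y = ∅)
    {n : ℕ} {x : ℕ → V} (hx : IsPath A n x)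
    (hchord : ∀ i j, i + 2 ≤ j → j ≤ n → ¬ A (x i) (x j)) (hn : r ≤ n) :
    obstrOpen AH ρ n x = ∅ := by
  refine Finset.filter_eq_empty_iff.mpr fun i hi => ?_
  rw [Finset.mem_Ico] at hi
  obtain ⟨s, hs, his, hsn⟩ : ∃ s, s + 1 ≤ i ∧ i + 1 ≤ s + r ∧ s + r ≤ n :=
    ⟨min (i - 1) (n - r), by lia, by lia, by lia⟩
  obtain ⟨t, rfl⟩ : ∃ t, i = s + (t + 1) := ⟨i - s - 1, by lia⟩
  have hw : IsPath A r (fun m => x (s + m)) :=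
    ⟨fun m hm => hx.1 (s + m) (by lia), fun i hi j hj he => by
      have := hx.2 (s + i) (by lia) (s + j) (by lia) he
      lia⟩
  have hback := (hrqt _ hw).resolve_left (hchord _ _ (by lia) hsn)
  exact Finset.filter_eq_empty_iff.mp (hw.obstrOpen_eq_empty_of_arc hHcyc hback)
    (Finset.mem_Ico.mpr ⟨by lia, by lia⟩ : t + 1 ∈ Finset.Ico 1 r)

/-- The reachability relation of a finite digraph has a kernel. -/
lemma exists_reachability_kernel [Finite V] (A : V → V → Prop) :
    ∃ S : Set V, (∀ u ∈ S, ∀ v ∈ S, Relation.ReflTransGen A u v → u = v) ∧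
      ∀ v, ∃ w ∈ S, Relation.ReflTransGen A v w := by
  let _ : Preorder V :=
    { le := Relation.ReflTransGen A
      le_refl := fun _ => .refl
      le_trans := fun _ _ _ => .trans }
  let rep : V → V := fun v => ofAntisymmetrization (· ≤ ·) (toAntisymmetrization (· ≤ ·) v)
  have hrep : ∀ v, AntisymmRel (· ≤ ·) (rep v) v := fun v =>
    Quotient.exact (toAntisymmetrization_ofAntisymmetrization (· ≤ ·) _)
  refine ⟨{v | IsMax v ∧ rep v = v}, fun u hu v hv huv => ?_, fun v => ?_⟩
  · rw [← hu.2, ← hv.2]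
    exact congrArg (ofAntisymmetrization (· ≤ ·)) (Quotient.sound ⟨huv, hu.1 huv⟩)
  · obtain ⟨m, hvm, hm⟩ := Finite.exists_le_maximal (p := fun _ : V => True) (a := v) trivial
    have hmax : IsMax m := fun b hb => hm.2 trivial hb
    refine ⟨rep m, ⟨fun b hb => ?_, ?_⟩, le_trans hvm (hrep m).2⟩
    · exact (hmax ((hrep m).2.trans hb)).trans (hrep m).2
    · exact congrArg (ofAntisymmetrization (· ≤ ·)) (Quotient.sound (hrep m))

/-- Every `H`-colored `r`-quasi-transitive digraph (`r ≥ 2`) in which every cycle of length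
`r + 1` is an `H`-cycle has a `(k,H)`-kernel for every `k ≥ r`. -/
theorem rQuasiTransitive_has_kHKernel [Fintype V]
    (A : V → V → Prop) (hloopless : ∀ v : V, ¬ A v v)
    (r : ℕ) (hr : 2 ≤ r) (hrqt : RQuasiTransitive A r)
    (AH : VH → VH → Prop) (ρ : V → V → VH)
    (hHcyc : ∀ y : ℕ → V, IsCycle A (r + 1) y → obstrClosed AH ρ (r + 1) y = ∅)
    (k : ℕ) (hk : r ≤ k) :
    ∃ S : Set V, IsKHKernel A AH ρ k S := by
  obtain ⟨S, hind, habs⟩ := exists_reachability_kernel A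
  refine ⟨S, fun u hu v hv huv n x hx h0 hn => ?_, fun v _ => ?_⟩
  · subst h0 hn
    exact absurd (hind _ hu _ hv hx.1.reflTransGen) huv
  · obtain ⟨w, hw, hvw⟩ := habs v
    obtain ⟨n, x, hx, h0, hn, hchord⟩ := exists_isPath_of_reflTransGen hvw
    refine ⟨w, hw, n, x, hx, h0, hn, ?_⟩
    unfold HLenOpen
    rcases le_or_gt r n with h | h
    · rw [hx.obstrOpen_eq_empty hr hrqt hHcyc hchord h, Finset.card_empty]
      lia
    · have : (obstrOpen AH ρ n x).card ≤ n - 1 :=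
        (Finset.card_filter_le _ _).trans (Nat.card_Ico 1 n).le
      lia
end
end
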